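/- Let m ≥ 1 be an integer and let α, w be integers with w ≤ α. Then Δ₁(m, α, w) = 0 if and only if at least one of the following holds: (i) m = 1; (ii) w = α (i.e. d₀ := α − w = 0); (iii) α − w = 1 and m divides α (i.e. d₀ = 1 and σ̄ = gcd(m, α) = m). (This is the arithmetic content of the vanishing criterion for Δ₁ in Siefring's Lemma characterizing when the asymptotic index Δ₁ of a pseudoholomorphic end vanishes.) -/

import Mathlib

/-- Siefring's asymptotic index `Δ₁` in arithmetic form:
`Δ₁(m, α, w) = (m − 1)(α − w) − gcd(m, α) + gcd(m, w)`,
where `gcd` is the nonnegative greatest common divisor of integers. -/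
def Delta1 (m α w : ℤ) : ℤ :=
  (m - 1) * (α - w) - (Int.gcd m α : ℤ) + (Int.gcd m w : ℤ)

/-- Vanishing criterion for `Δ₁`: for `m ≥ 1` and `w ≤ α`, `Δ₁(m, α, w) = 0` if and only if
`m = 1`, or `w = α`, or `α − w = 1` and `m ∣ α`. -/
theorem delta1_eq_zero_iff (m α w : ℤ) (hm : 1 ≤ m) (hw : w ≤ α) :
    Delta1 m α w = 0 ↔ m = 1 ∨ w = α ∨ (α - w = 1 ∧ m ∣ α) := by
  have ha1 : (Int.gcd m α : ℤ) ∣ m := Int.gcd_dvd_left ..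
  have hw1 : (Int.gcd m w : ℤ) ∣ m := Int.gcd_dvd_left ..
  have ha2 : (Int.gcd m α : ℤ) ∣ α := Int.gcd_dvd_right ..
  have hw2 : (Int.gcd m w : ℤ) ∣ w := Int.gcd_dvd_right ..
  have ha3 : (Int.gcd m α : ℤ) ≤ m := Int.le_of_dvd (by omega) ha1
  have hw3 : (Int.gcd m w : ℤ) ≤ m := Int.le_of_dvd (by omega) hw1
  have ha4 : (0 : ℤ) < Int.gcd m α := by
    exact_mod_cast Int.gcd_pos_of_ne_zero_left α (by omega)
  have hw4 : (0 : ℤ) < Int.gcd m w := by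
    exact_mod_cast Int.gcd_pos_of_ne_zero_left w (by omega)
  unfold Delta1
  constructor
  · intro h
    by_cases h1 : m = 1
    · exact Or.inl h1
    by_cases h2 : w = α
    · exact Or.inr (Or.inl h2)
    have hm2 : 2 ≤ m := by omega
    have hd : α - w = 1 := by
      by_contra hne
      have hd2 : 2 ≤ α - w := by omega
      nlinarith
    refine Or.inr (Or.inr ⟨hd, ?_⟩)
    rw [hd] at h
    have hg : (Int.gcd m α : ℤ) = m := by linarith
    rwa [hg] at ha2
  · rintro (h | h | ⟨hd, hdvd⟩)
    · subst h
      simp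
    · subst h
      ring
    · have hg : (Int.gcd m α : ℤ) = m := le_antisymm ha3
        (Int.le_of_dvd ha4 (Int.dvd_coe_gcd dvd_rfl hdvd))
      have h1 : (Int.gcd m w : ℤ) ∣ 1 := hd ▸ dvd_sub (hw1.trans hdvd) hw2
      have h2 : (Int.gcd m w : ℤ) ≤ 1 := Int.le_of_dvd one_pos h1
      rw [hd, hg]
      linarith
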